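/- Generalized Young inequality: let f ∈ L^{p₁,q₁}(ℝⁿ) and φ ∈ L^{p₂,q₂}(ℝⁿ) with 1/p₁ + 1/p₂ > 1, let p₀ be defined by 1/p₁ + 1/p₂ − 1 = 1/p₀, and let q₀ ≥ 1 be any number such that 1/q₁ + 1/q₂ ≥ 1/q₀. Then f∗φ ∈ L^{p₀,q₀}(ℝⁿ) and ‖f∗φ‖_{p₀,q₀} ≤ 3 p₀ ‖f‖_{p₁,q₁} ‖φ‖_{p₂,q₂}. -/

import Mathlib

open MeasureTheory Set
open scoped ENNReal

/-- Distribution function: `μ {x : |f x| > s}`. -/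
noncomputable def distrib {X : Type*} [MeasurableSpace X] (μ : Measure X)
    (f : X → ℝ) (s : ℝ) : ℝ≥0∞ :=
  μ {x | s < |f x|}

/-- Decreasing rearrangement: `f*(t) = inf {s > 0 : λ_f(s) ≤ t}`. -/
noncomputable def rearr {X : Type*} [MeasurableSpace X] (μ : Measure X)
    (f : X → ℝ) (t : ℝ) : ℝ≥0∞ :=
  ⨅ (s : ℝ) (_ : 0 < s ∧ distrib μ f s ≤ ENNReal.ofReal t), ENNReal.ofReal s

/-- Maximal function `f**(t) = (1/t) ∫₀ᵗ f*(u) du`. -/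
noncomputable def maxFn {X : Type*} [MeasurableSpace X] (μ : Measure X)
    (f : X → ℝ) (t : ℝ) : ℝ≥0∞ :=
  (ENNReal.ofReal t)⁻¹ * ∫⁻ u in Set.Ioc (0:ℝ) t, rearr μ f u

/-- Lorentz norm `‖f‖_{p,q}`; for `q = ∞` it is `sup_{t>0} t^{1/p} f**(t)`. -/
noncomputable def lorentzNorm {X : Type*} [MeasurableSpace X] (μ : Measure X)
    (f : X → ℝ) (p : ℝ) (q : ℝ≥0∞) : ℝ≥0∞ :=
  if q = ⊤ then ⨆ (t : ℝ) (_ : 0 < t), ENNReal.ofReal t ^ (1/p) * maxFn μ f t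
  else (∫⁻ t in Set.Ioi (0:ℝ),
      (ENNReal.ofReal t ^ (1/p) * maxFn μ f t) ^ q.toReal * (ENNReal.ofReal t)⁻¹) ^ (1 / q.toReal)

/-- Convolution on ℝⁿ: `(f ∗ g)(x) = ∫ f(x-y) g(y) dy`. -/
noncomputable def conv {n : ℕ} (f g : EuclideanSpace ℝ (Fin n) → ℝ)
    (x : EuclideanSpace ℝ (Fin n)) : ℝ :=
  ∫ y, f (x - y) * g y

/-- `‖f‖_p = (∫ |f|^p dμ)^{1/p}`. -/
noncomputable def lpNorm {X : Type*} [MeasurableSpace X] (μ : Measure X)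
    (f : X → ℝ) (p : ℝ) : ℝ≥0∞ :=
  (∫⁻ x, ENNReal.ofReal |f x| ^ p ∂μ) ^ (1/p)

/-- Riesz potential `I_α f(x) = ∫ |x-y|^{α-n} f(y) dy` on ℝⁿ. -/
noncomputable def riesz (n : ℕ) (α : ℝ) (f : EuclideanSpace ℝ (Fin n) → ℝ)
    (x : EuclideanSpace ℝ (Fin n)) : ℝ :=
  ∫ y, ‖x - y‖ ^ (α - (n:ℝ)) * f y

/-- Layer-cake representation of an extended nonnegative number. -/
lemma volume_Ioi_ofReal_lt (c : ℝ≥0∞) :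
    volume.restrict (Ioi (0 : ℝ)) {a | ENNReal.ofReal a < c} = c := by
  rw [Measure.restrict_apply (measurableSet_lt (by fun_prop) (by fun_prop))]
  rcases eq_or_ne c ⊤ with rfl | hc
  · simp
  · have : {a | ENNReal.ofReal a < c} ∩ Ioi (0 : ℝ) = Ioo 0 c.toReal := by
      ext a
      simp only [mem_inter_iff, mem_ofPred_eq, mem_Ioi, mem_Ioo]
      constructor
      · rintro ⟨h, h0⟩
        exact ⟨h0, (ENNReal.ofReal_lt_iff_lt_toReal h0.le hc).1 h⟩
      · rintro ⟨h0, h⟩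
        exact ⟨(ENNReal.ofReal_lt_iff_lt_toReal h0.le hc).2 h, h0⟩
    rw [this, Real.volume_Ioo, sub_zero, ENNReal.ofReal_toReal hc]

lemma volume_Ioi_ofReal_le (c : ℝ≥0∞) :
    volume.restrict (Ioi (0 : ℝ)) {a | ENNReal.ofReal a ≤ c} = c := by
  rw [Measure.restrict_apply (measurableSet_le (by fun_prop) (by fun_prop))]
  rcases eq_or_ne c ⊤ with rfl | hc
  · simp
  · have : {a | ENNReal.ofReal a ≤ c} ∩ Ioi (0 : ℝ) = Ioc 0 c.toReal := by
      ext a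
      simp only [mem_inter_iff, mem_ofPred_eq, mem_Ioi, mem_Ioc]
      rw [ENNReal.ofReal_le_iff_le_toReal hc, and_comm]
    rw [this, Real.volume_Ioc, sub_zero, ENNReal.ofReal_toReal hc]

section Rearrangement

variable {X : Type*} [MeasurableSpace X] (μ : Measure X) (f : X → ℝ)

lemma distrib_antitone : Antitone (distrib μ f) := fun _ _ hab =>
  measure_mono fun _ hx => lt_of_le_of_lt hab hx

lemma measurable_distrib : Measurable (distrib μ f) := (distrib_antitone μ f).measurable

/-- The primitive `∫₀ᵗ f*` of the rearrangement, computed from the distribution function. -/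
noncomputable def rearrPrimitive (t : ℝ) : ℝ≥0∞ :=
  ∫⁻ a in Ioi (0 : ℝ), min (ENNReal.ofReal t) (distrib μ f a)

lemma rearrPrimitive_mono : Monotone (rearrPrimitive μ f) := fun _ _ hst =>
  lintegral_mono fun _ => min_le_min_right _ (ENNReal.ofReal_le_ofReal hst)

lemma rearr_eq_volume (u : ℝ) :
    rearr μ f u = volume.restrict (Ioi (0 : ℝ)) {a | ENNReal.ofReal u < distrib μ f a} := by
  apply le_antisymm
  · conv_lhs => rw [← volume_Ioi_ofReal_lt (rearr μ f u)]
    rw [Measure.restrict_apply' measurableSet_Ioi, Measure.restrict_apply' measurableSet_Ioi]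
    refine measure_mono ?_
    rintro a ⟨ha, ha0⟩
    refine ⟨?_, ha0⟩
    by_contra h
    exact (lt_of_lt_of_le ha (iInf₂_le (f := fun (s : ℝ) (_ : 0 < s ∧
      distrib μ f s ≤ ENNReal.ofReal u) => ENNReal.ofReal s) a ⟨ha0, not_lt.1 h⟩)).false
  · conv_rhs => rw [← volume_Ioi_ofReal_le (rearr μ f u)]
    refine measure_mono ?_
    intro a ha
    refine le_iInf₂ fun s hs => ENNReal.ofReal_le_ofReal ?_
    by_contra h
    exact (lt_of_lt_of_le ha ((distrib_antitone μ f (not_le.1 h).le).trans hs.2)).false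

lemma lintegral_rearr (t : ℝ) :
    ∫⁻ u in Ioc (0 : ℝ) t, rearr μ f u = rearrPrimitive μ f t := by
  have hm : MeasurableSet {z : ℝ × ℝ | ENNReal.ofReal z.1 < distrib μ f z.2} :=
    measurableSet_lt (by fun_prop) ((measurable_distrib μ f).comp measurable_snd)
  have h1 : ∀ u, rearr μ f u = ∫⁻ a in Ioi (0 : ℝ),
      {z : ℝ × ℝ | ENNReal.ofReal z.1 < distrib μ f z.2}.indicator 1 (u, a) := by
    intro u
    rw [rearr_eq_volume, ← lintegral_indicator_one
      (measurableSet_lt measurable_const (measurable_distrib μ f))]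
    rfl
  simp_rw [h1]
  rw [lintegral_lintegral_swap (f := fun u a =>
    {z : ℝ × ℝ | ENNReal.ofReal z.1 < distrib μ f z.2}.indicator 1 (u, a))
    (measurable_one.indicator hm).aemeasurable]
  refine lintegral_congr fun a => ?_
  have : ∀ u, {z : ℝ × ℝ | ENNReal.ofReal z.1 < distrib μ f z.2}.indicator (1 : ℝ × ℝ → ℝ≥0∞) (u, a)
    = {u : ℝ | ENNReal.ofReal u < distrib μ f a}.indicator 1 u := fun u => rfl
  simp_rw [this]
  have hm' : MeasurableSet {u : ℝ | ENNReal.ofReal u < distrib μ f a} :=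
    measurableSet_lt (by fun_prop) (by fun_prop)
  rw [lintegral_indicator_one hm', Measure.restrict_apply hm']
  apply le_antisymm
  · refine le_min ?_ ?_
    · refine (measure_mono inter_subset_right).trans ?_
      simp
    · conv_rhs => rw [← volume_Ioi_ofReal_lt (distrib μ f a)]
      rw [Measure.restrict_apply hm']
      exact measure_mono (inter_subset_inter_right _ Ioc_subset_Ioi_self)
  · conv_lhs => rw [← volume_Ioi_ofReal_lt (min _ _)]
    rw [Measure.restrict_apply' measurableSet_Ioi]
    refine measure_mono ?_
    rintro u ⟨hu, hu0⟩
    obtain ⟨hut, hud⟩ := lt_min_iff.1 (show ENNReal.ofReal u < min _ _ from hu)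
    exact ⟨hud, hu0, ((ENNReal.ofReal_lt_ofReal_iff_of_nonneg (le_of_lt hu0)).1 hut).le⟩

lemma maxFn_eq (t : ℝ) :
    maxFn μ f t = (ENNReal.ofReal t)⁻¹ * rearrPrimitive μ f t := by
  rw [maxFn, lintegral_rearr]

lemma measurable_maxFn : Measurable (maxFn μ f) := by
  have : maxFn μ f = fun t => (ENNReal.ofReal t)⁻¹ * rearrPrimitive μ f t :=
    funext (maxFn_eq μ f)
  rw [this]
  have := (rearrPrimitive_mono μ f).measurable
  fun_prop

lemma maxFn_eq_lintegral (t : ℝ) :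
    maxFn μ f t = ∫⁻ a in Ioi (0 : ℝ),
      (ENNReal.ofReal t)⁻¹ * min (ENNReal.ofReal t) (distrib μ f a) := by
  rw [maxFn_eq, rearrPrimitive, lintegral_const_mul]
  have := measurable_distrib μ f
  fun_prop

lemma inv_mul_min_eq {t : ℝ≥0∞} (h0 : t ≠ 0) (ht : t ≠ ⊤) (c : ℝ≥0∞) :
    t⁻¹ * min t c = min 1 (t⁻¹ * c) := by
  rw [mul_min, ENNReal.inv_mul_cancel h0 ht]

lemma maxFn_anti {s t : ℝ} (hs : 0 < s) (hst : s ≤ t) : maxFn μ f t ≤ maxFn μ f s := by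
  rw [maxFn_eq_lintegral, maxFn_eq_lintegral]
  refine lintegral_mono fun a => ?_
  rw [inv_mul_min_eq (by simpa using hs.trans_le hst) ENNReal.ofReal_ne_top,
    inv_mul_min_eq (by simpa using hs) ENNReal.ofReal_ne_top]
  gcongr

/-- If `|h| ≤ H + M`, the primitive of `h*` at `t` is at most `∫ H + t M`. -/
lemma rearrPrimitive_le_of_le_add [SFinite μ] {h : X → ℝ} {H : X → ℝ≥0∞} (hH : Measurable H)
    (M : ℝ≥0∞) (hh : ∀ x, ENNReal.ofReal |h x| ≤ H x + M) {t : ℝ} (ht : 0 < t) :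
    rearrPrimitive μ h t ≤ ∫⁻ x, H x ∂μ + ENNReal.ofReal t * M := by
  rcases eq_or_ne M ⊤ with rfl | hM
  · rw [ENNReal.mul_top (by simpa using ht)]
    simp
  set S : Set (ℝ × X) := {z | M < ENNReal.ofReal z.1 ∧ ENNReal.ofReal z.1 < H z.2 + M} with hS
  have hSm : MeasurableSet S := by
    rw [hS, ofPred_and]
    exact (measurableSet_lt (by fun_prop) (by fun_prop)).inter
      (measurableSet_lt (by fun_prop) (by fun_prop))
  have hSi : Measurable (S.indicator (1 : ℝ × X → ℝ≥0∞)) := measurable_one.indicator hSm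
  have hle : MeasurableSet {a : ℝ | ENNReal.ofReal a ≤ M} :=
    measurableSet_le (by fun_prop) (by fun_prop)
  have hpt : ∀ a ∈ Ioi (0 : ℝ), min (ENNReal.ofReal t) (distrib μ h a) ≤
      ENNReal.ofReal t * {a : ℝ | ENNReal.ofReal a ≤ M}.indicator 1 a
        + ∫⁻ x, S.indicator 1 (a, x) ∂μ := by
    intro a ha
    by_cases haM : ENNReal.ofReal a ≤ M
    · rw [indicator_of_mem (by exact haM)]
      simp only [Pi.one_apply, mul_one]
      exact (min_le_left _ _).trans le_self_add
    · refine (min_le_right _ _).trans (le_add_left ?_)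
      have : ∀ x, S.indicator (1 : ℝ × X → ℝ≥0∞) (a, x) = (Prod.mk a ⁻¹' S).indicator 1 x :=
        fun _ => rfl
      simp_rw [this]
      rw [lintegral_indicator_one (measurable_prodMk_left hSm)]
      refine measure_mono fun x hx => ⟨not_le.1 haM, lt_of_lt_of_le ?_ (hh x)⟩
      exact (ENNReal.ofReal_lt_ofReal_iff_of_nonneg (le_of_lt ha)).2 hx
  refine (setLIntegral_mono' measurableSet_Ioi hpt).trans ?_
  rw [lintegral_add_left ((measurable_one.indicator hle).const_mul _),
    lintegral_const_mul _ (measurable_one.indicator hle), lintegral_indicator_one hle,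
    volume_Ioi_ofReal_le, add_comm]
  refine add_le_add_left ?_ _
  rw [lintegral_lintegral_swap (f := fun a x => S.indicator 1 (a, x)) hSi.aemeasurable]
  refine lintegral_mono fun x => ?_
  have : ∀ a, S.indicator (1 : ℝ × X → ℝ≥0∞) (a, x) = ((fun a => (a, x)) ⁻¹' S).indicator 1 a :=
    fun _ => rfl
  simp_rw [this]
  rw [lintegral_indicator_one (measurable_prodMk_right hSm)]
  rcases eq_or_ne (H x) ⊤ with hx | hx
  · simp [hx]
  · rw [Measure.restrict_apply' measurableSet_Ioi]
    refine (measure_mono (t := Ioo M.toReal (M.toReal + (H x).toReal)) ?_).trans ?_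
    · rintro a ⟨⟨h1, h2⟩, h0⟩
      refine ⟨(ENNReal.lt_ofReal_iff_toReal_lt hM).1 h1, ?_⟩
      rw [← ENNReal.toReal_add hM hx, add_comm]
      exact (ENNReal.ofReal_lt_iff_lt_toReal (le_of_lt h0) (by finiteness)).1 h2
    · rw [Real.volume_Ioo, add_sub_cancel_left, ENNReal.ofReal_toReal hx]

end Rearrangement

section Convolution

variable {n : ℕ}

local notation "E" => EuclideanSpace ℝ (Fin n)

/-- The kernel `∫_t^∞ min(1, α/s) min(1, β/s) ds` in O'Neil's inequality. -/
noncomputable def oneilKernel (t : ℝ) (α β : ℝ≥0∞) : ℝ≥0∞ :=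
  ∫⁻ s in Ioi t, ((ENNReal.ofReal s)⁻¹ * min (ENNReal.ofReal s) α) *
    ((ENNReal.ofReal s)⁻¹ * min (ENNReal.ofReal s) β)

lemma lintegral_Ioi_rpow {a : ℝ} (ha : 0 < a) {t : ℝ} (ht : 0 < t) :
    ∫⁻ s in Ioi t, ENNReal.ofReal s ^ (-1 - a) = ENNReal.ofReal (t ^ (-a) / a) := by
  have h1 : ∫⁻ s in Ioi t, ENNReal.ofReal s ^ (-1 - a)
      = ∫⁻ s in Ioi t, ENNReal.ofReal (s ^ (-1 - a)) :=
    setLIntegral_congr_fun measurableSet_Ioi fun s hs =>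
      ENNReal.ofReal_rpow_of_pos (ht.trans hs)
  rw [h1, ← ofReal_integral_eq_lintegral_ofReal
    (integrableOn_Ioi_rpow_of_lt (by linarith) ht), integral_Ioi_rpow_of_lt (by linarith) ht]
  · congr 1
    rw [show -1 - a + 1 = -a by ring, div_neg, neg_div, neg_neg]
  · filter_upwards [ae_restrict_mem measurableSet_Ioi] with s hs
    exact Real.rpow_nonneg (ht.trans hs).le _

lemma lintegral_Ioc_rpow {a : ℝ} (ha : 0 < a) {t : ℝ} (ht : 0 < t) :
    ∫⁻ s in Ioc 0 t, ENNReal.ofReal s ^ (a - 1) = ENNReal.ofReal (t ^ a / a) := by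
  have h1 : ∫⁻ s in Ioc 0 t, ENNReal.ofReal s ^ (a - 1)
      = ∫⁻ s in Ioc 0 t, ENNReal.ofReal (s ^ (a - 1)) :=
    setLIntegral_congr_fun measurableSet_Ioc fun s hs =>
      ENNReal.ofReal_rpow_of_pos hs.1
  rw [h1, ← ofReal_integral_eq_lintegral_ofReal]
  · rw [← intervalIntegral.integral_of_le ht.le, integral_rpow (Or.inl (by linarith))]
    rw [sub_add_cancel, Real.zero_rpow ha.ne', sub_zero]
  · exact (intervalIntegrable_iff_integrableOn_Ioc_of_le ht.le).1
      (intervalIntegral.intervalIntegrable_rpow' (by linarith))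
  · filter_upwards [ae_restrict_mem measurableSet_Ioc] with s hs
    exact Real.rpow_nonneg hs.1.le _

lemma lintegral_Ioi_inv_sq {t : ℝ} (ht : 0 < t) :
    ∫⁻ s in Ioi t, (ENNReal.ofReal s)⁻¹ * (ENNReal.ofReal s)⁻¹ = (ENNReal.ofReal t)⁻¹ := by
  have h := lintegral_Ioi_rpow one_pos ht
  rw [div_one, Real.rpow_neg_one, ENNReal.ofReal_inv_of_pos ht] at h
  rw [← h]
  refine setLIntegral_congr_fun measurableSet_Ioi fun s hs => ?_
  have hs0 : ENNReal.ofReal s ≠ 0 := by simpa using ht.trans hs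
  rw [sub_eq_add_neg, ENNReal.rpow_add _ _ hs0 ENNReal.ofReal_ne_top, ENNReal.rpow_neg_one]

lemma oneilKernel_comm (t : ℝ) (α β : ℝ≥0∞) : oneilKernel t α β = oneilKernel t β α := by
  simp only [oneilKernel, mul_comm]

/-- Lower bound for the kernel by its tail. -/
lemma le_oneilKernel {t r : ℝ} (ht : 0 < t) (htr : t ≤ r) {α β a b : ℝ≥0∞}
    (ha : a ≤ α) (hb : b ≤ β) (har : a ≤ ENNReal.ofReal r) (hbr : b ≤ ENNReal.ofReal r) :
    a * b * (ENNReal.ofReal r)⁻¹ ≤ oneilKernel t α β := by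
  rw [← lintegral_Ioi_inv_sq (ht.trans_le htr), ← lintegral_const_mul _ (by fun_prop)]
  refine (setLIntegral_mono' measurableSet_Ioi fun s hs => ?_).trans
    (lintegral_mono_set (Ioi_subset_Ioi htr))
  have hrs : ENNReal.ofReal r ≤ ENNReal.ofReal s := ENNReal.ofReal_le_ofReal (le_of_lt hs)
  calc a * b * ((ENNReal.ofReal s)⁻¹ * (ENNReal.ofReal s)⁻¹)
      = ((ENNReal.ofReal s)⁻¹ * a) * ((ENNReal.ofReal s)⁻¹ * b) := by ring
    _ ≤ _ := by
      gcongr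
      · exact le_min (har.trans hrs) ha
      · exact le_min (hbr.trans hrs) hb

lemma mul_le_oneilKernel {t : ℝ} (ht : 0 < t) {α β : ℝ≥0∞}
    (hα : α ≤ ENNReal.ofReal t) (hβ : β ≤ ENNReal.ofReal t) :
    α * β ≤ ENNReal.ofReal t * oneilKernel t α β := by
  have h := le_oneilKernel ht le_rfl le_rfl le_rfl hα hβ
  have ht0 : ENNReal.ofReal t ≠ 0 := by simpa using ht
  rwa [← div_eq_mul_inv, ENNReal.div_le_iff' ht0 ENNReal.ofReal_ne_top] at h

lemma le_oneilKernel_of_lt {t : ℝ} (ht : 0 < t) {α β : ℝ≥0∞} (hαβ : α ≤ β)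
    (hβ : ENNReal.ofReal t < β) : α ≤ oneilKernel t α β := by
  refine le_of_forall_lt fun c hc => ?_
  obtain ⟨c', hcc', hc'⟩ := exists_between hc
  refine lt_of_lt_of_le hcc' ?_
  have hctop : c' ≠ ⊤ := hc'.ne_top
  set r := max t c'.toReal with hr
  have hr0 : 0 < r := ht.trans_le (le_max_left _ _)
  have hcr : c' ≤ ENNReal.ofReal r := by
    rw [← ENNReal.ofReal_toReal hctop]
    exact ENNReal.ofReal_le_ofReal (le_max_right _ _)
  have hrβ : ENNReal.ofReal r ≤ β := by
    rw [hr, ENNReal.ofReal_max, ENNReal.ofReal_toReal hctop]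
    exact max_le hβ.le (hc'.le.trans hαβ)
  have h := le_oneilKernel ht (le_max_left t c'.toReal) hc'.le hrβ hcr le_rfl
  rwa [mul_assoc, ENNReal.mul_inv_cancel (by simpa using hr0) ENNReal.ofReal_ne_top, mul_one] at h

lemma min_le_oneilKernel {t : ℝ} (ht : 0 < t) {α β : ℝ≥0∞}
    (h : ¬ (α ≤ ENNReal.ofReal t ∧ β ≤ ENNReal.ofReal t)) :
    min α β ≤ oneilKernel t α β := by
  rcases le_total α β with hαβ | hαβ
  · rw [min_eq_left hαβ]
    refine le_oneilKernel_of_lt ht hαβ (not_le.1 fun hβ => h ⟨hαβ.trans hβ, hβ⟩)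
  · rw [min_eq_right hαβ, oneilKernel_comm]
    refine le_oneilKernel_of_lt ht hαβ (not_le.1 fun hα => h ⟨hα, hαβ.trans hα⟩)

lemma ofReal_abs_conv_le (f g : E → ℝ) (x : E) :
    ENNReal.ofReal |conv f g x| ≤ ∫⁻ y, ENNReal.ofReal |f (x - y)| * ENNReal.ofReal |g y| := by
  rw [conv, ← Real.enorm_eq_ofReal_abs]
  refine (enorm_integral_le_lintegral_enorm _).trans_eq ?_
  simp_rw [enorm_mul, Real.enorm_eq_ofReal_abs]

/-- Indicator of the superlevel set `{|f| > a}`, jointly in `(a, x)`. -/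
noncomputable def superlevel (f : E → ℝ) (a : ℝ) (x : E) : ℝ≥0∞ :=
  {x | a < |f x|}.indicator 1 x

lemma superlevel_le_one (f : E → ℝ) (a : ℝ) (x : E) : superlevel f a x ≤ 1 :=
  indicator_le_self' (by simp) _

lemma measurable_superlevel {f : E → ℝ} (hf : Measurable f) :
    Measurable (fun z : ℝ × E => superlevel f z.1 z.2) := by
  have hm : MeasurableSet {z : ℝ × E | z.1 < |f z.2|} :=
    measurableSet_lt (by fun_prop) (by fun_prop)
  exact measurable_one.indicator hm

lemma lintegral_superlevel {f : E → ℝ} (hf : Measurable f) (a : ℝ) :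
    ∫⁻ x, superlevel f a x = distrib volume f a :=
  lintegral_indicator_one (measurableSet_lt (by fun_prop) (by fun_prop))

lemma lintegral_superlevel_left (f : E → ℝ) (x : E) :
    ∫⁻ a in Ioi (0 : ℝ), superlevel f a x = ENNReal.ofReal |f x| := by
  have : ∀ a, superlevel f a x = {a : ℝ | a < |f x|}.indicator 1 a := fun a => rfl
  simp_rw [this]
  have hm : MeasurableSet {a : ℝ | a < |f x|} := measurableSet_lt (by fun_prop) (by fun_prop)
  rw [lintegral_indicator_one hm, Measure.restrict_apply hm,
    show {a : ℝ | a < |f x|} ∩ Ioi 0 = Ioo 0 |f x| by ext a; simp [and_comm]]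
  simp

/-- O'Neil's inequality for the maximal function of a convolution. -/
lemma rearrPrimitive_conv_le {f g : E → ℝ} (hf : Measurable f) (hg : Measurable g)
    {t : ℝ} (ht : 0 < t) :
    rearrPrimitive volume (conv f g) t ≤
      ENNReal.ofReal t * ∫⁻ s in Ioi t, maxFn volume f s * maxFn volume g s := by
  set σ : Measure ℝ := volume.restrict (Ioi 0) with hσ
  set T := ENNReal.ofReal t with hT
  set α : ℝ → ℝ≥0∞ := distrib volume f with hα
  set β : ℝ → ℝ≥0∞ := distrib volume g with hβ
  have hαm : Measurable α := measurable_distrib volume f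
  have hβm : Measurable β := measurable_distrib volume g
  have hfm : Measurable (fun z : (ℝ × ℝ) × (E × E) => superlevel f z.1.1 (z.2.1 - z.2.2)) :=
    (measurable_superlevel hf).comp (by fun_prop : Measurable
      (fun z : (ℝ × ℝ) × (E × E) => (z.1.1, z.2.1 - z.2.2)))
  have hgm : Measurable (fun z : (ℝ × ℝ) × (E × E) => superlevel g z.1.2 z.2.2) :=
    (measurable_superlevel hg).comp (by fun_prop : Measurable
      (fun z : (ℝ × ℝ) × (E × E) => (z.1.2, z.2.2)))
  have hfgm := hfm.mul hgm
  set W : ℝ × ℝ → E → ℝ≥0∞ := fun p x => ∫⁻ y, superlevel f p.1 (x - y) * superlevel g p.2 y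
    with hW
  have hWm : Measurable (fun z : (ℝ × ℝ) × E => W z.1 z.2) := by
    refine Measurable.lintegral_prod_right' (f := fun q : ((ℝ × ℝ) × E) × E =>
      superlevel f q.1.1.1 (q.1.2 - q.2) * superlevel g q.1.1.2 q.2) ?_
    exact hfgm.comp (by fun_prop : Measurable
      (fun q : ((ℝ × ℝ) × E) × E => (q.1.1, (q.1.2, q.2))))
  have hWα : ∀ p x, W p x ≤ α p.1 := by
    intro p x
    calc W p x ≤ ∫⁻ y, superlevel f p.1 (x - y) :=
          lintegral_mono fun y => mul_le_of_le_one_right' (superlevel_le_one g _ _)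
      _ = α p.1 := by
          rw [lintegral_sub_left_eq_self (superlevel f p.1), lintegral_superlevel hf]
  have hWβ : ∀ p x, W p x ≤ β p.2 := by
    intro p x
    calc W p x ≤ ∫⁻ y, superlevel g p.2 y :=
          lintegral_mono fun y => mul_le_of_le_one_left' (superlevel_le_one f _ _)
      _ = β p.2 := lintegral_superlevel hg _
  have hWint : ∀ p, ∫⁻ x, W p x = α p.1 * β p.2 := by
    intro p
    rw [lintegral_lintegral_swap
      (f := fun x y => superlevel f p.1 (x - y) * superlevel g p.2 y)
      (hfgm.comp (measurable_prodMk_left (x := p))).aemeasurable]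
    have : ∀ y, ∫⁻ x, superlevel f p.1 (x - y) * superlevel g p.2 y
        = α p.1 * superlevel g p.2 y := by
      intro y
      rw [lintegral_mul_const]
      · rw [lintegral_sub_right_eq_self (superlevel f p.1), lintegral_superlevel hf]
      · exact (measurable_superlevel hf).comp (by fun_prop : Measurable
          (fun x : E => (p.1, x - y)))
    simp_rw [this]
    rw [lintegral_const_mul, lintegral_superlevel hg]
    exact (measurable_superlevel hg).comp measurable_prodMk_left
  have hH : ∀ x, ∫⁻ y, ENNReal.ofReal |f (x - y)| * ENNReal.ofReal |g y|
      = ∫⁻ p, W p x ∂σ.prod σ := by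
    intro x
    rw [lintegral_lintegral_swap
      (f := fun (p : ℝ × ℝ) y => superlevel f p.1 (x - y) * superlevel g p.2 y)
      (hfgm.comp (by fun_prop : Measurable
        (fun q : (ℝ × ℝ) × E => (q.1, (x, q.2))))).aemeasurable]
    refine lintegral_congr fun y => ?_
    rw [lintegral_prod_mul (f := fun a => superlevel f a (x - y))
      (g := fun b => superlevel g b y)
      ((measurable_superlevel hf).comp measurable_prodMk_right).aemeasurable
      ((measurable_superlevel hg).comp measurable_prodMk_right).aemeasurable,
      lintegral_superlevel_left, lintegral_superlevel_left]
  set S : Set (ℝ × ℝ) := {p | α p.1 ≤ T ∧ β p.2 ≤ T} with hS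
  have hSm : MeasurableSet S := by
    rw [hS, ofPred_and]
    exact (measurableSet_le (by fun_prop) (by fun_prop)).inter
      (measurableSet_le (by fun_prop) (by fun_prop))
  have hHle : ∀ x, ENNReal.ofReal |conv f g x| ≤
      ∫⁻ p in S, W p x ∂σ.prod σ + ∫⁻ p in Sᶜ, min (α p.1) (β p.2) ∂σ.prod σ := by
    intro x
    refine (ofReal_abs_conv_le f g x).trans ?_
    rw [hH, ← lintegral_add_compl _ hSm]
    gcongr
    exact le_min (hWα _ _) (hWβ _ _)
  have hWm' : Measurable (fun z : E × (ℝ × ℝ) => W z.2 z.1) := hWm.comp measurable_swap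
  have hHm : Measurable fun x => ∫⁻ p in S, W p x ∂σ.prod σ := hWm'.lintegral_prod_right'
  refine (rearrPrimitive_le_of_le_add volume hHm _ hHle ht).trans ?_
  have hK : Measurable fun p : ℝ × ℝ => oneilKernel t (α p.1) (β p.2) := by
    refine Measurable.lintegral_prod_right' (f := fun q : (ℝ × ℝ) × ℝ =>
      ((ENNReal.ofReal q.2)⁻¹ * min (ENNReal.ofReal q.2) (α q.1.1)) *
      ((ENNReal.ofReal q.2)⁻¹ * min (ENNReal.ofReal q.2) (β q.1.2))) (by fun_prop)
  calc (∫⁻ x, ∫⁻ p in S, W p x ∂σ.prod σ) + T * ∫⁻ p in Sᶜ, min (α p.1) (β p.2) ∂σ.prod σ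
      = ∫⁻ p in S, α p.1 * β p.2 ∂σ.prod σ
          + ∫⁻ p in Sᶜ, T * min (α p.1) (β p.2) ∂σ.prod σ := by
        rw [lintegral_lintegral_swap (f := fun x p => W p x) hWm'.aemeasurable,
          lintegral_const_mul _ (by fun_prop)]
        simp_rw [hWint]
    _ ≤ ∫⁻ p in S, T * oneilKernel t (α p.1) (β p.2) ∂σ.prod σ
          + ∫⁻ p in Sᶜ, T * oneilKernel t (α p.1) (β p.2) ∂σ.prod σ := by
        refine add_le_add (setLIntegral_mono' hSm fun p hp => ?_)
          (setLIntegral_mono' hSm.compl fun p hp => ?_)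
        · exact mul_le_oneilKernel ht hp.1 hp.2
        · gcongr
          exact min_le_oneilKernel ht hp
    _ = T * ∫⁻ p, oneilKernel t (α p.1) (β p.2) ∂σ.prod σ := by
        rw [lintegral_add_compl _ hSm, lintegral_const_mul _ hK]
    _ = _ := by
        congr 1
        simp only [oneilKernel]
        rw [lintegral_lintegral_swap (f := fun (p : ℝ × ℝ) s =>
          ((ENNReal.ofReal s)⁻¹ * min (ENNReal.ofReal s) (α p.1)) *
          ((ENNReal.ofReal s)⁻¹ * min (ENNReal.ofReal s) (β p.2)))
          (by simp only [Function.uncurry_def]; fun_prop)]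
        refine lintegral_congr fun s => ?_
        rw [lintegral_prod_mul
          (f := fun a => (ENNReal.ofReal s)⁻¹ * min (ENNReal.ofReal s) (α a))
          (g := fun b => (ENNReal.ofReal s)⁻¹ * min (ENNReal.ofReal s) (β b))
          (by fun_prop) (by fun_prop), maxFn_eq_lintegral, maxFn_eq_lintegral]

end Convolution

section Hardy

lemma lintegral_rpow_le_lintegral_rpow {α : Type*} [MeasurableSpace α] {ρ : Measure α}
    [IsProbabilityMeasure ρ] {u : α → ℝ≥0∞} (hu : Measurable u) {q : ℝ} (hq : 1 ≤ q) :
    (∫⁻ x, u x ∂ρ) ^ q ≤ ∫⁻ x, u x ^ q ∂ρ := by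
  rcases hq.eq_or_lt with rfl | hq1
  · simp
  have h := ENNReal.lintegral_mul_le_Lp_mul_Lq ρ (Real.HolderConjugate.conjExponent hq1)
    hu.aemeasurable (measurable_one (α := ℝ≥0∞)).aemeasurable
  simp only [mul_one, Pi.one_apply, ENNReal.one_rpow, lintegral_const, measure_univ] at h
  calc (∫⁻ x, u x ∂ρ) ^ q ≤ ((∫⁻ x, u x ^ q ∂ρ) ^ (1 / q)) ^ q := by gcongr
    _ = _ := by
      rw [← ENNReal.rpow_mul, one_div_mul_cancel (by linarith), ENNReal.rpow_one]

lemma rpow_one_add_mul_rpow {s : ℝ} (hs : 0 < s) (a : ℝ) :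
    ENNReal.ofReal s ^ (1 + a) * ENNReal.ofReal s ^ (-1 - a) = 1 := by
  rw [← ENNReal.rpow_add _ _ (by simpa using hs) ENNReal.ofReal_ne_top]
  simp

lemma lintegral_hardyWeight {a t : ℝ} (ha : 0 < a) (ht : 0 < t) :
    ∫⁻ s in Ioi t, ENNReal.ofReal a * ENNReal.ofReal t ^ a * ENNReal.ofReal s ^ (-1 - a) = 1 := by
  rw [lintegral_const_mul _ (by fun_prop), lintegral_Ioi_rpow ha ht,
    ENNReal.ofReal_rpow_of_pos ht, ← ENNReal.ofReal_mul ha.le,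
    ← ENNReal.ofReal_mul (by positivity), Real.rpow_neg ht.le]
  have := Real.rpow_pos_of_pos ht a
  field_simp
  simp

lemma rpow_mul_tail_eq {a t : ℝ} (ha : 0 < a) (ht : 0 < t) {k : ℝ → ℝ≥0∞} (hk : Measurable k) :
    ENNReal.ofReal t ^ a * ∫⁻ s in Ioi t, k s = ENNReal.ofReal (1 / a) *
      ∫⁻ s in Ioi t, (ENNReal.ofReal a * ENNReal.ofReal t ^ a * ENNReal.ofReal s ^ (-1 - a)) *
        (ENNReal.ofReal s ^ (1 + a) * k s) := by
  rw [← lintegral_const_mul _ hk, ← lintegral_const_mul _ (by fun_prop)]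
  refine setLIntegral_congr_fun measurableSet_Ioi fun s hs => ?_
  have h1 := rpow_one_add_mul_rpow (ht.trans hs) a
  have h2 : ENNReal.ofReal (1 / a) * ENNReal.ofReal a = 1 := by
    rw [← ENNReal.ofReal_mul (by positivity), one_div_mul_cancel ha.ne', ENNReal.ofReal_one]
  calc ENNReal.ofReal t ^ a * k s = (ENNReal.ofReal (1 / a) * ENNReal.ofReal a) *
        (ENNReal.ofReal s ^ (1 + a) * ENNReal.ofReal s ^ (-1 - a)) *
        (ENNReal.ofReal t ^ a * k s) := by rw [h1, h2, one_mul, one_mul]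
    _ = _ := by ring

lemma rpow_mul_tail_le {a t : ℝ} (ha : 0 < a) (ht : 0 < t) {k : ℝ → ℝ≥0∞} (hk : Measurable k)
    {C : ℝ≥0∞} (hC : ∀ s, 0 < s → ENNReal.ofReal s ^ (1 + a) * k s ≤ C) :
    ENNReal.ofReal t ^ a * ∫⁻ s in Ioi t, k s ≤ ENNReal.ofReal (1 / a) * C := by
  rw [rpow_mul_tail_eq ha ht hk]
  gcongr
  calc _ ≤ ∫⁻ s in Ioi t,
        (ENNReal.ofReal a * ENNReal.ofReal t ^ a * ENNReal.ofReal s ^ (-1 - a)) * C :=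
        setLIntegral_mono' measurableSet_Ioi fun s hs => by
          gcongr
          exact hC s (ht.trans hs)
    _ = C := by rw [lintegral_mul_const _ (by fun_prop), lintegral_hardyWeight ha ht, one_mul]

lemma rpow_mul_tail_rpow_le {a t q : ℝ} (ha : 0 < a) (ht : 0 < t) (hq : 1 ≤ q)
    {k : ℝ → ℝ≥0∞} (hk : Measurable k) :
    (ENNReal.ofReal t ^ a * ∫⁻ s in Ioi t, k s) ^ q ≤ ENNReal.ofReal (1 / a) ^ q *
      ∫⁻ s in Ioi t, (ENNReal.ofReal a * ENNReal.ofReal t ^ a * ENNReal.ofReal s ^ (-1 - a)) *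
        (ENNReal.ofReal s ^ (1 + a) * k s) ^ q := by
  rw [rpow_mul_tail_eq ha ht hk, ENNReal.mul_rpow_of_nonneg _ _ (by linarith)]
  gcongr
  set w : ℝ → ℝ≥0∞ := fun s =>
    ENNReal.ofReal a * ENNReal.ofReal t ^ a * ENNReal.ofReal s ^ (-1 - a) with hw
  have hwm : Measurable w := by fun_prop
  have : IsProbabilityMeasure ((volume.restrict (Ioi t)).withDensity w) :=
    ⟨by rw [withDensity_apply _ MeasurableSet.univ, Measure.restrict_univ,
      lintegral_hardyWeight ha ht]⟩
  have hu : Measurable fun s => ENNReal.ofReal s ^ (1 + a) * k s := by fun_prop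
  have h := lintegral_rpow_le_lintegral_rpow
    (ρ := (volume.restrict (Ioi t)).withDensity w) hu hq
  rwa [lintegral_withDensity_eq_lintegral_mul _ hwm hu,
    lintegral_withDensity_eq_lintegral_mul _ hwm (hu.pow_const q)] at h

lemma lintegral_Ioi_lintegral_Ioi_swap {G : ℝ → ℝ → ℝ≥0∞}
    (hG : Measurable (Function.uncurry G)) :
    ∫⁻ t in Ioi 0, ∫⁻ s in Ioi t, G t s = ∫⁻ s in Ioi 0, ∫⁻ t in Ioc 0 s, G t s := by
  set D : Set (ℝ × ℝ) := {z | z.1 < z.2} with hD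
  have hDm : MeasurableSet D := measurableSet_lt measurable_fst measurable_snd
  calc ∫⁻ t in Ioi 0, ∫⁻ s in Ioi t, G t s
      = ∫⁻ t in Ioi 0, ∫⁻ s in Ioi 0, D.indicator (Function.uncurry G) (t, s) := by
        refine setLIntegral_congr_fun measurableSet_Ioi fun t ht => ?_
        have h : ∀ s, D.indicator (Function.uncurry G) (t, s) = (Ioi t).indicator (G t) s :=
          fun s => rfl
        simp_rw [h]
        rw [setLIntegral_indicator measurableSet_Ioi,
          inter_eq_left.2 (Ioi_subset_Ioi (le_of_lt ht))]
    _ = ∫⁻ s in Ioi 0, ∫⁻ t in Ioi 0, D.indicator (Function.uncurry G) (t, s) :=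
        lintegral_lintegral_swap (f := fun t s => D.indicator (Function.uncurry G) (t, s))
          (hG.indicator hDm).aemeasurable
    _ = _ := by
        refine setLIntegral_congr_fun measurableSet_Ioi fun s hs => ?_
        have h : ∀ t, D.indicator (Function.uncurry G) (t, s)
            = (Iio s).indicator (fun t => G t s) t := fun t => rfl
        simp_rw [h]
        rw [setLIntegral_indicator measurableSet_Iio, inter_comm, Ioi_inter_Iio]
        exact setLIntegral_congr Ioo_ae_eq_Ioc

/-- Hardy's inequality for tails, with power weights. -/
lemma hardy_tail_le {a q : ℝ} (ha : 0 < a) (hq : 1 ≤ q) {k : ℝ → ℝ≥0∞} (hk : Measurable k) :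
    ∫⁻ t in Ioi 0, (ENNReal.ofReal t ^ a * ∫⁻ s in Ioi t, k s) ^ q * (ENNReal.ofReal t)⁻¹ ≤
      ENNReal.ofReal (1 / a) ^ q *
        ∫⁻ s in Ioi 0, (ENNReal.ofReal s ^ (1 + a) * k s) ^ q * (ENNReal.ofReal s)⁻¹ := by
  set u : ℝ → ℝ≥0∞ := fun s => (ENNReal.ofReal s ^ (1 + a) * k s) ^ q with hu
  have hum : Measurable u := by fun_prop
  set G : ℝ → ℝ → ℝ≥0∞ := fun t s =>
    (ENNReal.ofReal a * ENNReal.ofReal s ^ (-1 - a) * u s) * ENNReal.ofReal t ^ (a - 1) with hG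
  have hGm : Measurable (Function.uncurry G) := by
    simp only [hG, Function.uncurry_def]
    fun_prop
  have h1 : ∀ t ∈ Ioi (0 : ℝ),
      (ENNReal.ofReal t ^ a * ∫⁻ s in Ioi t, k s) ^ q * (ENNReal.ofReal t)⁻¹ ≤
        ENNReal.ofReal (1 / a) ^ q * ∫⁻ s in Ioi t, G t s := by
    intro t ht
    refine (mul_le_mul_left (rpow_mul_tail_rpow_le ha ht hq hk) _).trans_eq ?_
    rw [mul_assoc, ← lintegral_mul_const _ (by fun_prop)]
    congr 1
    refine lintegral_congr fun s => ?_
    simp only [hG, hu]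
    rw [sub_eq_add_neg a 1, ENNReal.rpow_add (x := ENNReal.ofReal t) a (-1) (by simpa using ht)
      ENNReal.ofReal_ne_top, ENNReal.rpow_neg_one]
    ring
  refine (setLIntegral_mono' measurableSet_Ioi h1).trans_eq ?_
  rw [lintegral_const_mul]
  swap
  · have h : (fun t => ∫⁻ s in Ioi t, G t s) = fun t => ∫⁻ s,
        {z : ℝ × ℝ | z.1 < z.2}.indicator (Function.uncurry G) (t, s) := by
      funext t
      rw [← lintegral_indicator measurableSet_Ioi]
      rfl
    rw [h]
    exact (hGm.indicator
      (measurableSet_lt measurable_fst measurable_snd)).lintegral_prod_right'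
  rw [lintegral_Ioi_lintegral_Ioi_swap hGm]
  congr 1
  refine setLIntegral_congr_fun measurableSet_Ioi fun s hs => ?_
  have hs0 : (0 : ℝ) < s := hs
  simp only [hG]
  rw [lintegral_const_mul _ (by fun_prop), lintegral_Ioc_rpow ha hs]
  have h2 : ENNReal.ofReal a * ENNReal.ofReal s ^ (-1 - a) * ENNReal.ofReal (s ^ a / a)
      = (ENNReal.ofReal s)⁻¹ := by
    rw [ENNReal.ofReal_rpow_of_pos hs0, ← ENNReal.ofReal_mul ha.le,
      ← ENNReal.ofReal_mul (by positivity), ← ENNReal.ofReal_inv_of_pos hs0,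
      show -1 - a = -1 + -a by ring, Real.rpow_add hs0, Real.rpow_neg hs0.le a, Real.rpow_neg_one]
    have := Real.rpow_pos_of_pos hs0 a
    congr 1
    field_simp
  rw [mul_right_comm, h2, mul_comm]

end Hardy

section Lorentz

variable {X : Type*} [MeasurableSpace X] (μ : Measure X) (f : X → ℝ)

lemma le_exp_half (q : ℝ) : q ≤ Real.exp (q / 2) := by
  rcases le_total q 0 with h | h
  · exact h.trans (Real.exp_pos _).le
  · nlinarith [Real.quadratic_le_exp_of_nonneg (x := q / 2) (by linarith), sq_nonneg (q - 2)]

lemma rpow_toReal_lorentzNorm {p : ℝ} {q : ℝ≥0∞} (hq : 1 ≤ q) (hqt : q ≠ ⊤) :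
    lorentzNorm μ f p q ^ q.toReal = ∫⁻ t in Ioi (0 : ℝ),
      (ENNReal.ofReal t ^ (1 / p) * maxFn μ f t) ^ q.toReal * (ENNReal.ofReal t)⁻¹ := by
  have : q.toReal ≠ 0 := (ENNReal.toReal_pos (one_pos.trans_le hq).ne' hqt).ne'
  rw [lorentzNorm, if_neg hqt, ← ENNReal.rpow_mul, one_div_mul_cancel this, ENNReal.rpow_one]

/-- The embedding `L^{p,q} ⊆ L^{p,∞}` with constant `√e`. -/
lemma rpow_mul_maxFn_le {p : ℝ} (hp : 1 ≤ p) {q : ℝ≥0∞} (hq : 1 ≤ q) {t : ℝ} (ht : 0 < t) :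
    ENNReal.ofReal t ^ (1 / p) * maxFn μ f t ≤
      ENNReal.ofReal (Real.exp (1 / 2)) * lorentzNorm μ f p q := by
  have hp0 : 0 < p := by linarith
  rcases eq_or_ne q ⊤ with rfl | hqt
  · rw [lorentzNorm, if_pos rfl]
    refine le_trans ?_ (le_mul_of_one_le_left' ?_)
    · exact le_iSup₂ (f := fun (t : ℝ) (_ : 0 < t) =>
        ENNReal.ofReal t ^ (1 / p) * maxFn μ f t) t ht
    · rw [ENNReal.one_le_ofReal]
      exact Real.one_le_exp (by norm_num)
  set r := q.toReal with hr
  have hr1 : 1 ≤ r := (ENNReal.ofReal_le_iff_le_toReal hqt).1 (by simpa using hq)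
  have hr0 : 0 < r := by linarith
  have hrp : 0 < r / p := by positivity
  rw [← ENNReal.rpow_le_rpow_iff hr0, ENNReal.mul_rpow_of_nonneg _ (lorentzNorm μ f p q) hr0.le,
    hr, rpow_toReal_lorentzNorm μ f hq hqt, ← hr]
  set m := maxFn μ f t ^ r with hm
  have h1 : m * ENNReal.ofReal (t ^ (r / p) / (r / p)) ≤ ∫⁻ s in Ioi (0 : ℝ),
      (ENNReal.ofReal s ^ (1 / p) * maxFn μ f s) ^ r * (ENNReal.ofReal s)⁻¹ := by
    rw [← lintegral_Ioc_rpow hrp ht, ← lintegral_const_mul _ (by fun_prop)]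
    refine (setLIntegral_mono' measurableSet_Ioc fun s hs => ?_).trans
      (lintegral_mono_set Ioc_subset_Ioi_self)
    rw [ENNReal.mul_rpow_of_nonneg _ _ hr0.le, ← ENNReal.rpow_mul, one_div_mul_eq_div,
      sub_eq_add_neg, ENNReal.rpow_add _ _ (by simpa using hs.1) ENNReal.ofReal_ne_top,
      ENNReal.rpow_neg_one, ← mul_assoc, mul_comm m]
    gcongr
    exact ENNReal.rpow_le_rpow (maxFn_anti μ f hs.1 hs.2) hr0.le
  calc (ENNReal.ofReal t ^ (1 / p) * maxFn μ f t) ^ r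
      = ENNReal.ofReal (t ^ (r / p)) * m := by
        rw [ENNReal.mul_rpow_of_nonneg _ _ hr0.le, ← ENNReal.rpow_mul, one_div_mul_eq_div,
          ENNReal.ofReal_rpow_of_pos ht]
    _ = ENNReal.ofReal (r / p) * (m * ENNReal.ofReal (t ^ (r / p) / (r / p))) := by
        rw [mul_left_comm, ← ENNReal.ofReal_mul hrp.le, mul_div_cancel₀ _ hrp.ne', mul_comm]
    _ ≤ _ := by
        gcongr
        rw [ENNReal.ofReal_rpow_of_pos (Real.exp_pos _), ← Real.exp_mul, one_div_mul_eq_div]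
        exact ENNReal.ofReal_le_ofReal ((div_le_self hr0.le hp).trans (le_exp_half r))

lemma lintegral_rpow_le_of_le {α : Type*} [MeasurableSpace α] {ν : Measure α}
    {F : α → ℝ≥0∞} (hFm : Measurable F) {A : ℝ≥0∞} (hF : ∀ᵐ t ∂ν, F t ≤ A) {q r : ℝ}
    (hq : 0 ≤ q) (hqr : q ≤ r) (hFq : ∫⁻ t, F t ^ q ∂ν ≤ A ^ q) :
    ∫⁻ t, F t ^ r ∂ν ≤ A ^ r := by
  have hr : r = q + (r - q) := by ring
  calc ∫⁻ t, F t ^ r ∂ν ≤ ∫⁻ t, F t ^ q * A ^ (r - q) ∂ν := by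
        refine lintegral_mono_ae (hF.mono fun t ht => ?_)
        conv_lhs => rw [hr]
        rw [ENNReal.rpow_add_of_nonneg _ _ hq (by linarith)]
        gcongr
    _ ≤ A ^ q * A ^ (r - q) := by
        rw [lintegral_mul_const _ (by fun_prop)]
        gcongr
    _ = A ^ r := by
        conv_rhs => rw [hr]
        rw [ENNReal.rpow_add_of_nonneg _ _ hq (by linarith)]

/-- Hölder's inequality with a surplus in the exponents, for functions that are also bounded. -/
lemma lintegral_mul_rpow_le {α : Type*} [MeasurableSpace α] {ν : Measure α}
    {F G : α → ℝ≥0∞} (hFm : Measurable F) (hGm : Measurable G) {A B : ℝ≥0∞}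
    (hF : ∀ᵐ t ∂ν, F t ≤ A) (hG : ∀ᵐ t ∂ν, G t ≤ B) {q₁ q₂ : ℝ≥0∞} {q : ℝ}
    (hq₁ : 1 ≤ q₁) (hq₂ : 1 ≤ q₂) (hq : 1 ≤ q)
    (hqq : (ENNReal.ofReal q)⁻¹ ≤ q₁⁻¹ + q₂⁻¹)
    (hFq : q₁ ≠ ⊤ → ∫⁻ t, F t ^ q₁.toReal ∂ν ≤ A ^ q₁.toReal)
    (hGq : q₂ ≠ ⊤ → ∫⁻ t, G t ^ q₂.toReal ∂ν ≤ B ^ q₂.toReal) :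
    ∫⁻ t, (F t * G t) ^ q ∂ν ≤ (A * B) ^ q := by
  have hq0 : 0 < q := by linarith
  by_cases h₁ : q₁ ≤ ENNReal.ofReal q
  · have hF' := lintegral_rpow_le_of_le hFm hF ENNReal.toReal_nonneg
      (ENNReal.toReal_le_of_le_ofReal hq0.le h₁) (hFq (h₁.trans_lt ENNReal.ofReal_lt_top).ne)
    calc ∫⁻ t, (F t * G t) ^ q ∂ν ≤ ∫⁻ t, F t ^ q * B ^ q ∂ν := by
          refine lintegral_mono_ae (hG.mono fun t ht => ?_)
          rw [ENNReal.mul_rpow_of_nonneg _ _ hq0.le]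
          gcongr
      _ ≤ _ := by
          rw [lintegral_mul_const _ (by fun_prop), ENNReal.mul_rpow_of_nonneg _ _ hq0.le]
          gcongr
  by_cases h₂ : q₂ ≤ ENNReal.ofReal q
  · have hG' := lintegral_rpow_le_of_le hGm hG ENNReal.toReal_nonneg
      (ENNReal.toReal_le_of_le_ofReal hq0.le h₂) (hGq (h₂.trans_lt ENNReal.ofReal_lt_top).ne)
    calc ∫⁻ t, (F t * G t) ^ q ∂ν ≤ ∫⁻ t, A ^ q * G t ^ q ∂ν := by
          refine lintegral_mono_ae (hF.mono fun t ht => ?_)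
          rw [ENNReal.mul_rpow_of_nonneg _ _ hq0.le]
          gcongr
      _ ≤ _ := by
          rw [lintegral_const_mul _ (by fun_prop), ENNReal.mul_rpow_of_nonneg _ _ hq0.le]
          gcongr
  rw [not_le] at h₁ h₂
  have hq₁t : q₁ ≠ ⊤ := by
    rintro rfl
    rw [ENNReal.inv_top, zero_add, ENNReal.inv_le_inv] at hqq
    exact (hqq.trans_lt h₂).false
  have hq₂t : q₂ ≠ ⊤ := by
    rintro rfl
    rw [ENNReal.inv_top, add_zero, ENNReal.inv_le_inv] at hqq
    exact (hqq.trans_lt h₁).false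
  lift q₁ to NNReal using hq₁t
  lift q₂ to NNReal using hq₂t
  have hFq := hFq ENNReal.coe_ne_top
  have hGq := hGq ENNReal.coe_ne_top
  simp only [ENNReal.coe_toReal] at hFq hGq
  have hr₁ : q < q₁ := by
    rwa [← ENNReal.ofReal_coe_nnreal, ENNReal.ofReal_lt_ofReal_iff_of_nonneg hq0.le] at h₁
  have hr₂ : q < q₂ := by
    rwa [← ENNReal.ofReal_coe_nnreal, ENNReal.ofReal_lt_ofReal_iff_of_nonneg hq0.le] at h₂
  have h₁0 : (0 : ℝ) < q₁ := hq0.trans hr₁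
  have h₂0 : (0 : ℝ) < q₂ := hq0.trans hr₂
  have hqq' : q⁻¹ ≤ (q₁ : ℝ)⁻¹ + (q₂ : ℝ)⁻¹ := by
    rwa [← ENNReal.ofReal_coe_nnreal, ← ENNReal.ofReal_coe_nnreal,
      ← ENNReal.ofReal_inv_of_pos hq0, ← ENNReal.ofReal_inv_of_pos h₁0,
      ← ENNReal.ofReal_inv_of_pos h₂0, ← ENNReal.ofReal_add (by positivity) (by positivity),
      ENNReal.ofReal_le_ofReal_iff (by positivity)] at hqq
  have hc1 : 1 < q₁ / q := by rwa [one_lt_div hq0]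
  have hc := Real.HolderConjugate.conjExponent hc1
  set r := Real.conjExponent (q₁ / q) with hr
  have hr0 : 0 < r := hc.symm.pos
  have hqr : q₂ ≤ q * r := by
    have h := hc.inv_add_inv_eq_one
    have h3 : (q * r)⁻¹ ≤ (q₂ : ℝ)⁻¹ := by
      have : (q * r)⁻¹ = q⁻¹ - (q₁ : ℝ)⁻¹ := by
        rw [mul_inv, show r⁻¹ = 1 - ((q₁ : ℝ) / q)⁻¹ by linarith]
        field_simp
      linarith
    exact (inv_le_inv₀ (by positivity) h₂0).1 h3
  have hG' := lintegral_rpow_le_of_le hGm hG h₂0.le hqr hGq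
  calc ∫⁻ t, (F t * G t) ^ q ∂ν
      = ∫⁻ t, ((fun t => F t ^ q) * fun t => G t ^ q) t ∂ν := by
        simp only [Pi.mul_apply, ENNReal.mul_rpow_of_nonneg _ _ hq0.le]
    _ ≤ (∫⁻ t, (F t ^ q) ^ (q₁ / q : ℝ) ∂ν) ^ (1 / (q₁ / q : ℝ)) *
        (∫⁻ t, (G t ^ q) ^ r ∂ν) ^ (1 / r) :=
        ENNReal.lintegral_mul_le_Lp_mul_Lq ν hc (by fun_prop) (by fun_prop)
    _ ≤ (A ^ (q₁ : ℝ)) ^ (1 / (q₁ / q : ℝ)) * (B ^ (q * r)) ^ (1 / r) := by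
        simp_rw [← ENNReal.rpow_mul, mul_div_cancel₀ _ hq0.ne'] at hG' ⊢
        simp_rw [ENNReal.rpow_mul] at hG' ⊢
        gcongr
    _ = (A * B) ^ q := by
        rw [ENNReal.mul_rpow_of_nonneg _ _ hq0.le, ← ENNReal.rpow_mul, ← ENNReal.rpow_mul]
        congr 2
        · field_simp
        · field_simp

end Lorentz

/-- **Generalized Young inequality** on Lorentz spaces: if `f ∈ L^{p₁,q₁}(ℝⁿ)`,
`φ ∈ L^{p₂,q₂}(ℝⁿ)`, `1/p₁ + 1/p₂ > 1`, `1/p₁ + 1/p₂ - 1 = 1/p₀` and `q₀ ≥ 1`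
satisfies `1/q₁ + 1/q₂ ≥ 1/q₀`, then `f∗φ ∈ L^{p₀,q₀}(ℝⁿ)` with
`‖f∗φ‖_{p₀,q₀} ≤ 3 p₀ ‖f‖_{p₁,q₁} ‖φ‖_{p₂,q₂}`. -/
theorem generalized_young_inequality (n : ℕ)
    (f φ : EuclideanSpace ℝ (Fin n) → ℝ) (hf : Measurable f) (hφ : Measurable φ)
    (p₁ p₂ p₀ : ℝ) (q₁ q₂ q₀ : ℝ≥0∞)
    (hp₁ : 1 ≤ p₁) (hp₂ : 1 ≤ p₂)
    (hq₁ : 1 ≤ q₁) (hq₂ : 1 ≤ q₂) (hq₀ : 1 ≤ q₀)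
    (hpp : 1 / p₁ + 1 / p₂ > 1)
    (hp₀ : 1 / p₁ + 1 / p₂ - 1 = 1 / p₀)
    (hqq : 1 / q₁ + 1 / q₂ ≥ 1 / q₀)
    (hfL : lorentzNorm volume f p₁ q₁ < ⊤)
    (hφL : lorentzNorm volume φ p₂ q₂ < ⊤) :
    lorentzNorm volume (conv f φ) p₀ q₀ < ⊤ ∧
      lorentzNorm volume (conv f φ) p₀ q₀ ≤
        ENNReal.ofReal (3 * p₀) * lorentzNorm volume f p₁ q₁ *
          lorentzNorm volume φ p₂ q₂ := by
  have h0 : 0 < 1 / p₀ := by linarith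
  have hp₀0 : 0 < p₀ := one_div_pos.1 h0
  suffices h : lorentzNorm volume (conv f φ) p₀ q₀ ≤
      ENNReal.ofReal (3 * p₀) * lorentzNorm volume f p₁ q₁ * lorentzNorm volume φ p₂ q₂ from
    ⟨h.trans_lt (by finiteness), h⟩
  set A := ENNReal.ofReal (Real.exp (1 / 2)) * lorentzNorm volume f p₁ q₁ with hA
  set B := ENNReal.ofReal (Real.exp (1 / 2)) * lorentzNorm volume φ p₂ q₂ with hB
  set F : ℝ → ℝ≥0∞ := fun t => ENNReal.ofReal t ^ (1 / p₁) * maxFn volume f t with hF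
  set G : ℝ → ℝ≥0∞ := fun t => ENNReal.ofReal t ^ (1 / p₂) * maxFn volume φ t with hG
  set k : ℝ → ℝ≥0∞ := fun s => maxFn volume f s * maxFn volume φ s with hk
  have hmf := measurable_maxFn volume f
  have hmφ := measurable_maxFn volume φ
  have hFm : Measurable F := by fun_prop
  have hGm : Measurable G := by fun_prop
  have hkm : Measurable k := by fun_prop
  have hFA : ∀ t, 0 < t → F t ≤ A := fun t ht => rpow_mul_maxFn_le volume f hp₁ hq₁ ht
  have hGB : ∀ t, 0 < t → G t ≤ B := fun t ht => rpow_mul_maxFn_le volume φ hp₂ hq₂ ht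
  have hFG : ∀ s, 0 < s → ENNReal.ofReal s ^ (1 + 1 / p₀) * k s = F s * G s := by
    intro s hs
    rw [show 1 + 1 / p₀ = 1 / p₁ + 1 / p₂ by linarith,
      ENNReal.rpow_add _ _ (by simpa using hs) ENNReal.ofReal_ne_top]
    simp only [hF, hG, hk]
    ring
  have hmax : ∀ t, 0 < t → maxFn volume (conv f φ) t ≤ ∫⁻ s in Ioi t, k s := by
    intro t ht
    rw [maxFn_eq, mul_comm, ← div_eq_mul_inv]
    exact ENNReal.div_le_of_le_mul' (rearrPrimitive_conv_le hf hφ ht)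
  have hconst : ENNReal.ofReal p₀ * (A * B) ≤
      ENNReal.ofReal (3 * p₀) * lorentzNorm volume f p₁ q₁ * lorentzNorm volume φ p₂ q₂ := by
    have he : ENNReal.ofReal (Real.exp (1 / 2)) * ENNReal.ofReal (Real.exp (1 / 2))
        ≤ ENNReal.ofReal 3 := by
      rw [← ENNReal.ofReal_mul (Real.exp_pos _).le, ← Real.exp_add, add_halves]
      exact ENNReal.ofReal_le_ofReal (Real.exp_one_lt_d9.le.trans (by norm_num))
    calc ENNReal.ofReal p₀ * (A * B)
        = (ENNReal.ofReal (Real.exp (1 / 2)) * ENNReal.ofReal (Real.exp (1 / 2)))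
          * ENNReal.ofReal p₀ * lorentzNorm volume f p₁ q₁ * lorentzNorm volume φ p₂ q₂ := by
          rw [hA, hB]
          ring
      _ ≤ _ := by
          rw [ENNReal.ofReal_mul (by norm_num)]
          gcongr
  refine le_trans ?_ hconst
  rcases eq_or_ne q₀ ⊤ with rfl | hqt
  · rw [lorentzNorm, if_pos rfl]
    refine iSup₂_le fun t ht => ?_
    have h := rpow_mul_tail_le h0 ht hkm (C := A * B) fun s hs => by
      rw [hFG s hs]
      exact mul_le_mul' (hFA s hs) (hGB s hs)
    rw [one_div_one_div] at h
    exact (mul_le_mul_right (hmax t ht) _).trans h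
  have hr1 : 1 ≤ q₀.toReal := (ENNReal.ofReal_le_iff_le_toReal hqt).1 (by simpa using hq₀)
  have hr0 : 0 < q₀.toReal := by linarith
  rw [← ENNReal.rpow_le_rpow_iff hr0, rpow_toReal_lorentzNorm volume _ hq₀ hqt]
  set ν : Measure ℝ := (volume.restrict (Ioi 0)).withDensity fun t => (ENNReal.ofReal t)⁻¹ with hν
  have hlint : ∀ u : ℝ → ℝ≥0∞, Measurable u →
      ∫⁻ t, u t ∂ν = ∫⁻ t in Ioi 0, u t * (ENNReal.ofReal t)⁻¹ := by
    intro u hu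
    rw [hν, lintegral_withDensity_eq_lintegral_mul _ (by fun_prop) hu]
    simp only [Pi.mul_apply, mul_comm]
  have hpos : ∀ᵐ t ∂ν, 0 < t :=
    (withDensity_absolutelyContinuous _ _).ae_le (ae_restrict_mem measurableSet_Ioi)
  have hexp : 1 ≤ ENNReal.ofReal (Real.exp (1 / 2)) := by
    rw [ENNReal.one_le_ofReal]
    exact Real.one_le_exp (by norm_num)
  have hFq : q₁ ≠ ⊤ → ∫⁻ t, F t ^ q₁.toReal ∂ν ≤ A ^ q₁.toReal := by
    intro hq
    rw [hlint _ (by fun_prop), ← rpow_toReal_lorentzNorm volume f hq₁ hq]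
    exact ENNReal.rpow_le_rpow (le_mul_of_one_le_left' hexp) ENNReal.toReal_nonneg
  have hGq : q₂ ≠ ⊤ → ∫⁻ t, G t ^ q₂.toReal ∂ν ≤ B ^ q₂.toReal := by
    intro hq
    rw [hlint _ (by fun_prop), ← rpow_toReal_lorentzNorm volume φ hq₂ hq]
    exact ENNReal.rpow_le_rpow (le_mul_of_one_le_left' hexp) ENNReal.toReal_nonneg
  have hHolder : ∫⁻ t, (F t * G t) ^ q₀.toReal ∂ν ≤ (A * B) ^ q₀.toReal :=
    lintegral_mul_rpow_le hFm hGm (hpos.mono hFA) (hpos.mono hGB) hq₁ hq₂ hr1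
      (by simpa [ENNReal.ofReal_toReal hqt] using hqq) hFq hGq
  calc ∫⁻ t in Ioi (0 : ℝ), (ENNReal.ofReal t ^ (1 / p₀) * maxFn volume (conv f φ) t) ^ q₀.toReal
        * (ENNReal.ofReal t)⁻¹
      ≤ ∫⁻ t in Ioi (0 : ℝ), (ENNReal.ofReal t ^ (1 / p₀) * ∫⁻ s in Ioi t, k s) ^ q₀.toReal
        * (ENNReal.ofReal t)⁻¹ :=
        setLIntegral_mono' measurableSet_Ioi fun t ht => by
          gcongr
          exact hmax t ht
    _ ≤ ENNReal.ofReal (1 / (1 / p₀)) ^ q₀.toReal * ∫⁻ s in Ioi 0,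
          (ENNReal.ofReal s ^ (1 + 1 / p₀) * k s) ^ q₀.toReal * (ENNReal.ofReal s)⁻¹ :=
        hardy_tail_le h0 hr1 hkm
    _ = ENNReal.ofReal p₀ ^ q₀.toReal * ∫⁻ t, (F t * G t) ^ q₀.toReal ∂ν := by
        rw [one_div_one_div, hlint _ (by fun_prop)]
        congr 1
        refine setLIntegral_congr_fun measurableSet_Ioi fun s hs => ?_
        simp only [hFG s hs]
    _ ≤ (ENNReal.ofReal p₀ * (A * B)) ^ q₀.toReal := by
        rw [ENNReal.mul_rpow_of_nonneg _ _ hr0.le]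
        gcongr
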